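/- Let k be a field of characteristic 0 and let β₂(k) be the k-vector space generated by symbols ⟨a⟩ for a ∈ k^♭, modulo the k-subspace spanned by the four-term elements ⟨p⟩ - ⟨q⟩ + p·⟨q/p⟩ + (1-p)·⟨(1-q)/(1-p)⟩ for all p, q ∈ k^♭ with p ≠ q. Then for every p ∈ k^♭, the class of ⟨p⁻¹⟩ in β₂(k) equals -(1/p) times the class of ⟨p⟩. -/

import Mathlib

open Finsupp

/-- `k^♭`: the set of elements `a` with both `a` and `1 - a` units, as a subtype. -/
abbrev kflat (k : Type*) [Field k] : Type _ := {a : k // IsUnit a ∧ IsUnit (1 - a)}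

/-- The four-term relations of Cathelineau inside the free `k`-vector space on `k^♭`:
`⟨p⟩ - ⟨q⟩ + p·⟨q/p⟩ + (1-p)·⟨(1-q)/(1-p)⟩` for `p ≠ q` in `k^♭`. -/
def fourTermSet (k : Type*) [Field k] : Set (kflat k →₀ k) :=
  {v | ∃ p q r s : kflat k, (p : k) ≠ (q : k) ∧ (r : k) = (q : k) / (p : k) ∧
    (s : k) = (1 - (q : k)) / (1 - (p : k)) ∧
    v = single p 1 - single q 1 + (p : k) • single r 1 + (1 - (p : k)) • single s 1}

/-- `β₂(k)`: the free `k`-vector space on `k^♭` modulo the four-term relations. -/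
abbrev beta2 (k : Type*) [Field k] : Type _ :=
  (kflat k →₀ k) ⧸ Submodule.span k (fourTermSet k)

/-- The class of the generator `⟨a⟩` in `β₂(k)`. -/
noncomputable def beta2Mk {k : Type*} [Field k] (a : kflat k) : beta2 k :=
  Submodule.Quotient.mk (single a 1)

/-- The four-term relation in `β₂(k)`. -/
theorem beta2Mk_four_term {k : Type*} [Field k] (p q r s : kflat k) (hpq : (p : k) ≠ q)
    (hr : (r : k) = q / p) (hs : (s : k) = (1 - q) / (1 - p)) :
    beta2Mk p - beta2Mk q + (p : k) • beta2Mk r + (1 - (p : k)) • beta2Mk s = 0 :=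
  (Submodule.Quotient.mk_eq_zero _).2 <|
    Submodule.subset_span ⟨p, q, r, s, hpq, hr, hs, rfl⟩

theorem beta2_symbol_inv (k : Type*) [Field k] [CharZero k] :
    ∀ p q : kflat k, (q : k) = (p : k)⁻¹ →
      beta2Mk q = -((p : k)⁻¹ • beta2Mk p) := by
  rintro x y hy
  have hx0 : (x : k) ≠ 0 := x.2.1.ne_zero
  have hx1 : 1 - (x : k) ≠ 0 := x.2.2.ne_zero
  have hx1' : (x : k) - 1 ≠ 0 := sub_ne_zero.2 (sub_ne_zero.1 hx1).symm
  by_cases hx : (x : k) + 1 = 0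
  · have hx' : (x : k) = -1 := eq_neg_of_add_eq_zero_left hx
    obtain rfl : y = x := Subtype.ext (by rw [hy, hx']; norm_num)
    simp [hx', inv_neg]
  -- Choose `p`, `q` with `q / p = x` and `(1 - q) / (1 - p) = -1`.
  have hp : 1 - 2 / ((x : k) + 1) = (x - 1) / (x + 1) := by field_simp; ring
  have hq : 1 - 2 * (x : k) / (x + 1) = (1 - x) / (x + 1) := by field_simp; ring
  let p : kflat k := ⟨2 / (x + 1), (div_ne_zero two_ne_zero hx).isUnit, by
    rw [hp]; exact (div_ne_zero hx1' hx).isUnit⟩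
  let q : kflat k := ⟨2 * x / (x + 1), (div_ne_zero (mul_ne_zero two_ne_zero hx0) hx).isUnit, by
    rw [hq]; exact (div_ne_zero hx1 hx).isUnit⟩
  let m : kflat k := ⟨-1, isUnit_one.neg, by norm_num⟩
  have hpq : (p : k) ≠ q := by
    intro h
    have h' : (2 : k) / (x + 1) = 2 * x / (x + 1) := h
    field_simp at h'
    exact hx1 (sub_eq_zero.2 h')
  have h₁ := beta2Mk_four_term p q x m hpq
    (by simp only [p, q]; field_simp) (by simp only [p, q, m, hp, hq]; field_simp; ring)
  have h₂ := beta2Mk_four_term q p y m hpq.symm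
    (by simp only [p, q, hy]; field_simp) (by simp only [p, q, m, hp, hq]; field_simp; ring)
  have hqx : (q : k) = p * x := by simp only [p, q]; ring
  have hsum : (1 - (p : k)) + (1 - (q : k)) = 0 := by
    simp only [p, q, hp, hq]; ring
  have key : (p : k) • (beta2Mk x + (x : k) • beta2Mk y) = 0 := by
    rw [smul_add, smul_smul, ← hqx]
    have hm : (1 - (p : k)) • beta2Mk m + (1 - (q : k)) • beta2Mk m = 0 := by
      rw [← add_smul, hsum, zero_smul]
    linear_combination (norm := module) h₁ + h₂ - hm
  have h := (smul_eq_zero.1 key).resolve_left p.2.1.ne_zero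
  rw [eq_neg_of_add_eq_zero_left h, smul_neg, neg_neg, inv_smul_smul₀ hx0]
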